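/- Let 0 < α ≤ 1 and let M be a sequence of positive reals with M₀ = 1 such that the sequence (j^{(1-α)j}·M_j)_j (convention 0⁰ := 1) is equivalent to a log-convex sequence L with L₀ = 1. Define the two-parametric Mittag-Leffler-type function Ẽ_α(z) := ∑_{j=0}^∞ (−1)^j·z^j/Γ((2−α)(j+1)+2), where Γ is the Gamma function. Then T_L(Ẽ_α) belongs to A_{{M}}(S_α) and is characteristic in the class A_{{M}}(S_α). -/

import Mathlib

open Filter Complex Asymptotics
open scoped Topology BigOperators

noncomputable section

/-- The open sector in ℂ of opening `α·π` bisected by the positive real axis. -/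
def Sector (α : ℝ) : Set ℂ := {z : ℂ | z ≠ 0 ∧ |Complex.arg z| < α * Real.pi / 2}

/-- The Roumieu ultraholomorphic class `A_{{M}}(S_α)`. -/
def ASet (M : ℕ → ℝ) (α : ℝ) : Set (ℂ → ℂ) :=
  {f | DifferentiableOn ℂ f (Sector α) ∧
    ∃ h > (0:ℝ), ∃ C : ℝ, ∀ j : ℕ, ∀ z ∈ Sector α,
      ‖iteratedDerivWithin j f (Sector α) z‖ ≤ C * h ^ j * M j}

/-- Equivalence of sequences: `a_j ≤ A·B^j·b_j` and `b_j ≤ A·B^j·a_j`. -/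
def SeqEquiv (a b : ℕ → ℝ) : Prop :=
  ∃ A > (0:ℝ), ∃ B > (0:ℝ), ∀ j : ℕ, a j ≤ A * B ^ j * b j ∧ b j ≤ A * B ^ j * a j

/-- Log-convexity: `L_j² ≤ L_{j-1}·L_{j+1}` for `j ≥ 1`. -/
def IsLogConvexSeq (L : ℕ → ℝ) : Prop := ∀ j : ℕ, L (j+1) ^ 2 ≤ L j * L (j+2)

/-- `Gbar s j = j^{s·j}` (with the convention `0⁰ = 1`, automatic for `rpow`). -/
def Gbar (s : ℝ) (j : ℕ) : ℝ := (j : ℝ) ^ (s * (j : ℝ))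

/-- Weight matrix: positive sequences, first term 1, nondecreasing in the parameter. -/
def IsWeightMatrix (M : ℝ → ℕ → ℝ) : Prop :=
  (∀ p > (0:ℝ), ∀ j : ℕ, 0 < M p j) ∧ (∀ p > (0:ℝ), M p 0 = 1) ∧
    (∀ p q : ℝ, 0 < p → p ≤ q → ∀ j : ℕ, M p j ≤ M q j)

/-- The class `A_{{𝓜}}(S_α)` associated with a weight matrix. -/
def AMatSet (M : ℝ → ℕ → ℝ) (α : ℝ) : Set (ℂ → ℂ) := {f | ∃ p > (0:ℝ), f ∈ ASet (M p) α}

/-- `M̌_j = M_j/j!`. -/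
def checkSeq (N : ℕ → ℝ) (j : ℕ) : ℝ := N j / (Nat.factorial j : ℝ)

/-- Condition `(𝓜_{rai})`. -/
def Mrai (M : ℝ → ℕ → ℝ) : Prop :=
  ∀ p > (0:ℝ), ∃ C > (0:ℝ), ∃ p' > (0:ℝ), ∀ j k : ℕ, 1 ≤ j → j ≤ k →
    (checkSeq (M p) j) ^ ((j:ℝ)⁻¹) ≤ C * (checkSeq (M p') k) ^ ((k:ℝ)⁻¹)

/-- Condition `(𝓜_{C^ω})`. -/
def MComega (M : ℝ → ℕ → ℝ) : Prop :=
  ∃ p > (0:ℝ),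
    0 < Filter.liminf (fun j : ℕ => (checkSeq (M p) j) ^ ((j:ℝ)⁻¹)) Filter.atTop

/-- Condition `(𝓜_{dc})`. -/
def Mdc (M : ℝ → ℕ → ℝ) : Prop :=
  ∀ p > (0:ℝ), ∃ C > (0:ℝ), ∃ p' > (0:ℝ), ∀ j : ℕ, M p (j+1) ≤ C ^ (j+1) * M p' j

/-- `N°_k`: maximum of `N_ℓ·N_{j₁}⋯N_{j_ℓ}` over `j_i ∈ ℕ, j₁+⋯+j_ℓ = k`; `N°₀ = 1`. -/
def circSeq (N : ℕ → ℝ) (k : ℕ) : ℝ :=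
  if k = 0 then 1 else
    sSup {x : ℝ | ∃ (l : ℕ) (js : Fin l → ℕ), (∀ i, 1 ≤ js i) ∧ (∑ i, js i) = k ∧
      x = N l * ∏ i, N (js i)}

/-- `(rai)` for a single sequence. -/
def SeqRai (N : ℕ → ℝ) : Prop :=
  ∃ C > (0:ℝ), ∀ j k : ℕ, 1 ≤ j → j ≤ k →
    (checkSeq N j) ^ ((j:ℝ)⁻¹) ≤ C * (checkSeq N k) ^ ((k:ℝ)⁻¹)

/-- `(dc)` for a single sequence. -/
def SeqDc (N : ℕ → ℝ) : Prop := ∃ D ≥ (1:ℝ), ∀ j : ℕ, N (j+1) ≤ D ^ (j+1) * N j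

/-- `(FdB)` for a single sequence. -/
def SeqFdB (N : ℕ → ℝ) : Prop :=
  ∃ C ≥ (1:ℝ), ∃ h ≥ (1:ℝ), ∀ j : ℕ, circSeq (checkSeq N) j ≤ C * h ^ j * checkSeq N j

/-- Condition `(𝓜_{FdB})`. -/
def MFdB (M : ℝ → ℕ → ℝ) : Prop :=
  ∀ p > (0:ℝ), ∃ p' > (0:ℝ), ∃ C : ℝ, ∀ k : ℕ, 1 ≤ k →
    (circSeq (checkSeq (M p)) k / checkSeq (M p') k) ^ ((k:ℝ)⁻¹) ≤ C

/-- `L` is the log-convex minorant of `a` (within positive log-convex sequences). -/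
def IsLcMinorant (a L : ℕ → ℝ) : Prop :=
  (∀ j, 0 < L j) ∧ IsLogConvexSeq L ∧ (∀ j, L j ≤ a j) ∧
    ∀ L' : ℕ → ℝ, (∀ j, 0 < L' j) → IsLogConvexSeq L' → (∀ j, L' j ≤ a j) → ∀ j, L' j ≤ L j

/-- Holomorphic closedness of a class of functions on `S_α`. -/
def HolClosed (S : Set (ℂ → ℂ)) (α : ℝ) : Prop :=
  ∀ f ∈ S, ∀ U : Set ℂ, IsOpen U → closure (f '' Sector α) ⊆ U →
    ∀ g : ℂ → ℂ, DifferentiableOn ℂ g U → g ∘ f ∈ S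

/-- Inverse closedness of a class of functions on `S_α`. -/
def InvClosed (S : Set (ℂ → ℂ)) (α : ℝ) : Prop :=
  ∀ f ∈ S, (∃ c > (0:ℝ), ∀ z ∈ Sector α, c ≤ ‖f z‖) → (fun z => (f z)⁻¹) ∈ S

/-- The class `H_{{𝓜}}(U)` for a weight matrix. -/
def HMatClass (M : ℝ → ℕ → ℝ) (U : Set ℂ) : Set (ℂ → ℂ) :=
  {g | DifferentiableOn ℂ g U ∧ ∀ K : Set ℂ, K ⊆ U → IsCompact K →
    ∃ p > (0:ℝ), ∃ h > (0:ℝ), ∃ C : ℝ, ∀ j : ℕ, ∀ z ∈ K,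
      ‖iteratedDerivWithin j g U z‖ ≤ C * h ^ j * M p j}

/-- The class `H_{{M}}(U)` for a single sequence. -/
def HSeqClass (N : ℕ → ℝ) (U : Set ℂ) : Set (ℂ → ℂ) :=
  {g | DifferentiableOn ℂ g U ∧ ∀ K : Set ℂ, K ⊆ U → IsCompact K →
    ∃ h > (0:ℝ), ∃ C : ℝ, ∀ j : ℕ, ∀ z ∈ K,
      ‖iteratedDerivWithin j g U z‖ ≤ C * h ^ j * N j}

/-- Closedness under composition for the matrix class. -/
def CompClosedMat (M : ℝ → ℕ → ℝ) (α : ℝ) : Prop :=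
  ∀ f ∈ AMatSet M α, ∀ U : Set ℂ, IsOpen U → closure (f '' Sector α) ⊆ U →
    ∀ g ∈ HMatClass M U, g ∘ f ∈ AMatSet M α

/-- Closedness under composition for a single-sequence class. -/
def CompClosedSeq (N : ℕ → ℝ) (α : ℝ) : Prop :=
  ∀ f ∈ ASet N α, ∀ U : Set ℂ, IsOpen U → closure (f '' Sector α) ⊆ U →
    ∀ g ∈ HSeqClass N U, g ∘ f ∈ ASet N α

/-- `f` is characteristic in `A_{{L}}(S_α)`. -/
def Characteristic (L : ℕ → ℝ) (α : ℝ) (f : ℂ → ℂ) : Prop :=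
  f ∈ ASet L α ∧ ∀ N : ℕ → ℝ, (∀ j, 0 < N j) → N 0 = 1 →
    f ∈ ASet N α → ASet N α ⊆ ASet L α → ASet N α = ASet L α

/-- Coefficient `2^{-n} M_n/m_n^n` of the `T_M`-transform. -/
def coefT (M : ℕ → ℝ) (n : ℕ) : ℝ := (1/2:ℝ)^n * (M n / (M (n+1) / M n) ^ n)

/-- The sequence of quotients `m_n = M_{n+1}/M_n`. -/
def quotSeq (M : ℕ → ℝ) (n : ℕ) : ℝ := M (n+1) / M n

/-- `R_j = ∑ 2^{-n}(M_n/m_n^n) m_n^j` (as a real tsum). -/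
def Rseq (M : ℕ → ℝ) (j : ℕ) : ℝ := ∑' n : ℕ, coefT M n * (quotSeq M n) ^ j

/-- The `T_M`-transform. -/
def Ttrans (M : ℕ → ℝ) (f : ℂ → ℂ) (z : ℂ) : ℂ :=
  ∑' n : ℕ, (coefT M n : ℂ) * f ((quotSeq M n : ℂ) * z)

/-- Weight function: continuous, nondecreasing, `ω(0)=0`, nonnegative, `ω(t)→∞`. -/
def IsWeightFunction (ω : ℝ → ℝ) : Prop :=
  ContinuousOn ω (Set.Ici 0) ∧ MonotoneOn ω (Set.Ici 0) ∧ ω 0 = 0 ∧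
    (∀ t ≥ (0:ℝ), 0 ≤ ω t) ∧ Filter.Tendsto ω Filter.atTop Filter.atTop

def Om0 (ω : ℝ → ℝ) : Prop := ∀ t ∈ Set.Icc (0:ℝ) 1, ω t = 0
def Om1 (ω : ℝ → ℝ) : Prop := ∃ L ≥ (1:ℝ), ∀ t ≥ (0:ℝ), ω (2*t) ≤ L * (ω t + 1)
def Om2 (ω : ℝ → ℝ) : Prop := ∃ C > (0:ℝ), ∃ t₀ : ℝ, ∀ t ≥ t₀, ω t ≤ C * t
def Om3 (ω : ℝ → ℝ) : Prop := Real.log =o[Filter.atTop] ω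
def Om4 (ω : ℝ → ℝ) : Prop := ConvexOn ℝ Set.univ (fun t => ω (Real.exp t))
def Om5 (ω : ℝ → ℝ) : Prop := ω =o[Filter.atTop] (fun t => t)
def Om6 (ω : ℝ → ℝ) : Prop := ∃ H ≥ (1:ℝ), ∀ t ≥ (0:ℝ), 2 * ω t ≤ ω (H * t) + H

/-- Condition `(α₀)` for a weight function. -/
def Alpha0 (ω : ℝ → ℝ) : Prop :=
  ∃ C ≥ (1:ℝ), ∃ t₀ ≥ (0:ℝ), ∀ lam ≥ (1:ℝ), ∀ t ≥ t₀, ω (lam * t) ≤ C * lam * ω t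

/-- The set `W₀`. -/
def InW0 (ω : ℝ → ℝ) : Prop := IsWeightFunction ω ∧ Om0 ω ∧ Om3 ω ∧ Om4 ω

/-- The set `W`. -/
def InW (ω : ℝ → ℝ) : Prop := InW0 ω ∧ Om1 ω

/-- The Legendre–Fenchel–Young conjugate `φ*_ω`. -/
def phiStar (ω : ℝ → ℝ) (x : ℝ) : ℝ :=
  sSup {r : ℝ | ∃ y : ℝ, 0 ≤ y ∧ r = x * y - ω (Real.exp y)}

/-- The weight matrix associated with `ω`: `W^{(ℓ)}_j = exp((1/ℓ)·φ*_ω(ℓj))`. -/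
def Wmat (ω : ℝ → ℝ) (ℓ : ℝ) (j : ℕ) : ℝ := Real.exp ((1/ℓ) * phiStar ω (ℓ * (j:ℝ)))

/-- The class `A_{{ω}}(S_α)`. -/
def AOmegaSet (ω : ℝ → ℝ) (α : ℝ) : Set (ℂ → ℂ) :=
  {f | DifferentiableOn ℂ f (Sector α) ∧ ∃ ℓ > (0:ℝ), ∃ C : ℝ,
    ∀ j : ℕ, ∀ z ∈ Sector α, ‖iteratedDerivWithin j f (Sector α) z‖ ≤ C * Wmat ω ℓ j}

/-- Closedness under composition for the `ω`-class. -/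
def CompClosedOmega (ω : ℝ → ℝ) (α : ℝ) : Prop :=
  ∀ f ∈ AOmegaSet ω α, ∀ U : Set ℂ, IsOpen U → closure (f '' Sector α) ⊆ U →
    ∀ g ∈ HMatClass (Wmat ω) U, g ∘ f ∈ AOmegaSet ω α

/-- One-sided matrix comparison `𝓜 {⪯} 𝓛`: `sup_{j≥1}(M^{(p)}_j/L^{(q)}_j)^{1/j} < ∞`. -/
def MatPreceq (M L : ℝ → ℕ → ℝ) : Prop :=
  ∀ p > (0:ℝ), ∃ q > (0:ℝ), ∃ C : ℝ, ∀ j : ℕ, 1 ≤ j → (M p j / L q j) ^ ((j:ℝ)⁻¹) ≤ C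

/-- `R`-equivalence of weight matrices. -/
def REquivMat (M L : ℝ → ℕ → ℝ) : Prop := MatPreceq M L ∧ MatPreceq L M

open MeasureTheory

lemma x_integrable_base (b c : ℝ) (hb : 0 < b) (hc : 0 < c) :
    IntegrableOn (fun t : ℝ => t ^ (b - 1) * Real.exp (-c * t)) (Set.Ioi 0) := by
  have := integrableOn_rpow_mul_exp_neg_mul_rpow (p := 1) (s := b - 1) (b := c)
    (by linarith) one_pos hc
  simpa using this

lemma x_meas (b : ℝ) (r : ℂ) : AEStronglyMeasurable
    (fun t : ℝ => ((t ^ (b - 1) : ℝ) : ℂ) * cexp (-(r * t))) (volume.restrict (Set.Ioi 0)) := by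
  have : Measurable (fun t : ℝ => ((t ^ (b - 1) : ℝ) : ℂ) * cexp (-(r * t))) := by fun_prop
  exact this.aestronglyMeasurable

lemma x_norm (b : ℝ) (r : ℂ) (t : ℝ) (ht : 0 < t) :
    ‖((t ^ (b - 1) : ℝ) : ℂ) * cexp (-(r * t))‖ = t ^ (b - 1) * Real.exp (-r.re * t) := by
  rw [norm_mul, Complex.norm_exp, Complex.norm_real, Real.norm_of_nonneg (by positivity)]
  simp

lemma x_integrable (b : ℝ) (hb : 0 < b) (r : ℂ) (hr : 0 < r.re) : IntegrableOn
    (fun t : ℝ => ((t ^ (b - 1) : ℝ) : ℂ) * cexp (-(r * t))) (Set.Ioi 0) := by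
  refine (x_integrable_base b r.re hb hr).mono' (x_meas b r) ?_
  filter_upwards [ae_restrict_mem measurableSet_Ioi] with t ht
  exact (x_norm b r t ht).le

lemma x_deriv (b : ℝ) (hb : 0 < b) (r : ℂ) (hr : 0 < r.re) : DifferentiableAt ℂ
    (fun r : ℂ => ∫ t in Set.Ioi (0:ℝ), ((t ^ (b - 1) : ℝ) : ℂ) * cexp (-(r * t))) r := by
  have hs : {w : ℂ | r.re / 2 < w.re} ∈ 𝓝 r := by
    apply (isOpen_lt continuous_const Complex.continuous_re).mem_nhds
    simp; linarith
  refine (hasDerivAt_integral_of_dominated_loc_of_deriv_le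
    (F' := fun w (t:ℝ) => ((t ^ (b - 1) : ℝ) : ℂ) * (cexp (-(w * t)) * (-t)))
    (bound := fun t => t ^ (b + 1 - 1) * Real.exp (-(r.re/2) * t)) hs
    (Eventually.of_forall fun w => x_meas b w) (x_integrable b hb r hr) ?_ ?_
    (x_integrable_base (b+1) (r.re/2) (by linarith) (by linarith)) ?_).2.differentiableAt
  · have : Measurable (fun t : ℝ => ((t ^ (b - 1) : ℝ) : ℂ) * (cexp (-(r * t)) * (-t))) := by
      fun_prop
    exact this.aestronglyMeasurable
  · filter_upwards [ae_restrict_mem measurableSet_Ioi] with t ht w hw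
    have ht' : 0 < t := ht
    rw [← mul_assoc, norm_mul, x_norm b w t ht, norm_neg, Complex.norm_real,
      Real.norm_of_nonneg ht'.le]
    have : t ^ (b + 1 - 1) = t ^ (b - 1) * t := by
      rw [← Real.rpow_add_one ht'.ne']; ring_nf
    rw [this]
    have h2 : Real.exp (-w.re * t) ≤ Real.exp (-(r.re/2) * t) := by
      apply Real.exp_le_exp.mpr
      have : r.re / 2 < w.re := hw
      nlinarith
    have : 0 ≤ t ^ (b-1) * t := by positivity
    nlinarith
  · refine Eventually.of_forall fun t w _ => ?_
    refine HasDerivAt.const_mul _ ?_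
    refine HasDerivAt.cexp ?_
    have := ((hasDerivAt_id w).mul_const (t:ℂ)).fun_neg
    simpa using this

lemma x_laplace (b : ℝ) (hb : 0 < b) (r : ℂ) (hr : 0 < r.re) :
    ∫ t in Set.Ioi (0:ℝ), ((t ^ (b - 1) : ℝ) : ℂ) * cexp (-(r * t)) =
      r ^ (-(b:ℂ)) * (Real.Gamma b : ℂ) := by
  set U : Set ℂ := {w : ℂ | 0 < w.re}
  have hU : IsOpen U := isOpen_lt continuous_const Complex.continuous_re
  have hUc : IsPreconnected U := (convex_halfSpace_re_gt 0).isPreconnected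
  have h1 : AnalyticOnNhd ℂ (fun r : ℂ => ∫ t in Set.Ioi (0:ℝ),
      ((t ^ (b - 1) : ℝ) : ℂ) * cexp (-(r * t))) U :=
    (Complex.analyticOnNhd_iff_differentiableOn hU).2
      fun w hw => (x_deriv b hb w hw).differentiableWithinAt
  have h2 : AnalyticOnNhd ℂ (fun r : ℂ => r ^ (-(b:ℂ)) * (Real.Gamma b : ℂ)) U := by
    refine (Complex.analyticOnNhd_iff_differentiableOn hU).2 fun w hw => ?_
    have : w ∈ slitPlane := Or.inl hw
    exact ((differentiableAt_id.cpow_const (Or.inl hw)).mul_const _).differentiableWithinAt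
  have hreal : ∀ x : ℝ, 0 < x → (∫ t in Set.Ioi (0:ℝ),
      ((t ^ (b - 1) : ℝ) : ℂ) * cexp (-((x:ℂ) * t))) = (x:ℂ) ^ (-(b:ℂ)) * (Real.Gamma b : ℂ) := by
    intro x hx
    have := Complex.integral_cpow_mul_exp_neg_mul_Ioi (a := (b:ℂ)) (r := x) (by simpa using hb) hx
    rw [Complex.Gamma_ofReal] at this
    rw [cpow_neg, ← one_div, show (1:ℂ) / (x:ℂ)^(b:ℂ) = (1 / (x:ℂ)) ^ (b:ℂ) by
      rw [one_div, one_div, ← ofReal_inv, ← ofReal_cpow hx.le, ← ofReal_cpow (by positivity),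
        Real.inv_rpow hx.le]; push_cast; rfl]
    rw [← this]
    refine setIntegral_congr_fun measurableSet_Ioi fun t ht => ?_
    have ht' : 0 < t := ht
    rw [ofReal_cpow ht'.le]; push_cast; rfl
  refine h1.eqOn_of_preconnected_of_frequently_eq h2 hUc (z₀ := 1) (by simp [U]) ?_ hr
  have htend : Tendsto (fun n : ℕ => (((1 + 1/((n:ℝ)+1) : ℝ)) : ℂ)) atTop (𝓝[≠] 1) := by
    refine tendsto_nhdsWithin_iff.2 ⟨?_, Eventually.of_forall fun n => ?_⟩
    · have := (tendsto_one_div_add_atTop_nhds_zero_nat (𝕜 := ℝ)).const_add 1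
      rw [add_zero] at this
      exact_mod_cast (Complex.continuous_ofReal.tendsto 1).comp this
    · have : (0:ℝ) < 1/((n:ℝ)+1) := by positivity
      simp only [Set.mem_compl_iff, Set.mem_singleton_iff]
      intro h
      have h' : (1 + 1/((n:ℝ)+1) : ℝ) = 1 := by exact_mod_cast h
      linarith
  exact htend.frequently (Eventually.of_forall fun n => hreal _ (by positivity)).frequently

/-- The vertical line. -/
def sLine (c ξ : ℝ) : ℂ := c + (2 * Real.pi * ξ : ℝ) * I

lemma sLine_re (c ξ : ℝ) : (sLine c ξ).re = c := by simp [sLine]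
lemma sLine_im (c ξ : ℝ) : (sLine c ξ).im = 2 * Real.pi * ξ := by simp [sLine]

lemma sLine_cont (c : ℝ) : Continuous (sLine c) := by unfold sLine; fun_prop

lemma sLine_ne (c ξ : ℝ) (hc : 1 ≤ c) : sLine c ξ ≠ 0 := by
  intro h; have := sLine_re c ξ; rw [h] at this; simp at this; linarith

lemma sLine_norm_ge (c ξ : ℝ) (hc : 1 ≤ c) : c ≤ ‖sLine c ξ‖ := by
  have := Complex.re_le_norm (sLine c ξ); rwa [sLine_re] at this

lemma sLine_slit (c ξ : ℝ) (hc : 1 ≤ c) : sLine c ξ ∈ slitPlane := by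
  left; rw [sLine_re]; linarith

lemma sLine_norm_sq (c ξ : ℝ) (hc : 1 ≤ c) : 1 + ξ^2 ≤ ‖sLine c ξ‖^2 := by
  rw [Complex.sq_norm, Complex.normSq_apply, sLine_re, sLine_im]
  have h3 := Real.pi_gt_three
  have : 1 ≤ (2 * Real.pi)^2 := by nlinarith
  nlinarith [sq_nonneg ξ, mul_nonneg (sub_nonneg.2 this) (sq_nonneg ξ)]

lemma sLine_cpow_cont (c : ℝ) (hc : 1 ≤ c) (b : ℂ) : Continuous fun ξ => (sLine c ξ) ^ b := by
  rw [continuous_iff_continuousAt]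
  intro ξ
  exact ContinuousAt.cpow (sLine_cont c).continuousAt continuousAt_const (sLine_slit c ξ hc)

lemma sLine_cpow_norm (c : ℝ) (hc : 1 ≤ c) (b : ℝ) (hb : 2 ≤ b) (ξ : ℝ) :
    ‖(sLine c ξ) ^ (-(b:ℂ))‖ ≤ c ^ (2 - b) * (1 + ξ^2)⁻¹ := by
  rw [← ofReal_neg, Complex.norm_cpow_real]
  have h0 : 0 < ‖sLine c ξ‖ := norm_pos_iff.2 (sLine_ne c ξ hc)
  have : -b = (2 - b) + (-(2:ℕ):ℝ) := by push_cast; ring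
  rw [this, Real.rpow_add h0, Real.rpow_neg h0.le, Real.rpow_natCast]
  gcongr ?_ * ?_
  · exact Real.rpow_le_rpow_of_nonpos (by linarith) (sLine_norm_ge c ξ hc) (by linarith)
  · exact inv_anti₀ (by positivity) (sLine_norm_sq c ξ hc)

lemma x_bromwich_int (c : ℝ) (hc : 1 ≤ c) (b : ℝ) (hb : 2 ≤ b) :
    Integrable fun ξ => (sLine c ξ) ^ (-(b:ℂ)) := by
  refine (integrable_inv_one_add_sq.const_mul (c ^ (2 - b))).mono'
    (sLine_cpow_cont c hc _).aestronglyMeasurable (Eventually.of_forall fun ξ => ?_)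
  exact sLine_cpow_norm c hc b hb ξ

lemma x_bromwich (c : ℝ) (hc : 1 ≤ c) (b : ℝ) (hb : 2 ≤ b) :
    ∫ ξ, cexp (sLine c ξ) * (sLine c ξ) ^ (-(b:ℂ)) = ((Real.Gamma b : ℝ) : ℂ)⁻¹ := by
  set f : ℝ → ℂ := (Set.Ioi (0:ℝ)).indicator
    (fun t : ℝ => ((t ^ (b - 1) : ℝ) : ℂ) * cexp (-((c:ℂ) * t))) with hf
  have hfi : Integrable f := by
    rw [hf, integrable_indicator_iff measurableSet_Ioi]
    exact x_integrable b (by linarith) c (by simp; linarith)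
  have hF : FourierTransform.fourier f =
      fun ξ => (sLine c ξ) ^ (-(b:ℂ)) * (Real.Gamma b : ℂ) := by
    ext ξ
    rw [Real.fourier_real_eq_integral_exp_smul, ← x_laplace b (by linarith) (sLine c ξ)
      (by rw [sLine_re]; linarith), ← integral_indicator measurableSet_Ioi]
    congr 1 with t
    by_cases ht : t ∈ Set.Ioi (0:ℝ)
    · simp only [hf, Set.indicator_of_mem ht, smul_eq_mul]
      rw [mul_left_comm, ← Complex.exp_add]
      congr 2
      simp only [sLine]; push_cast; ring
    · simp [hf, Set.indicator_of_notMem ht]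
  have hG : (Real.Gamma b : ℂ) ≠ 0 := by
    exact_mod_cast (Real.Gamma_pos_of_pos (by linarith)).ne'
  have hinv := hfi.fourierInv_fourier_eq (v := 1) (by
    rw [hF]; exact (x_bromwich_int c hc b hb).mul_const _) (by
    have : f =ᶠ[𝓝 1] (fun t : ℝ => ((t ^ (b - 1) : ℝ) : ℂ) * cexp (-((c:ℂ) * t))) := by
      filter_upwards [Ioi_mem_nhds (zero_lt_one (α := ℝ))] with t ht
      simp [hf, Set.indicator_of_mem ht]
    refine ContinuousAt.congr ?_ this.symm
    refine ContinuousAt.mul ?_ (by fun_prop)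
    exact Complex.continuous_ofReal.continuousAt.comp
      (Real.continuousAt_rpow_const _ _ (Or.inl one_ne_zero)))
  rw [hF, Real.fourierInv_eq'] at hinv
  have h1 : f 1 = cexp (-(c:ℂ)) := by simp [hf]
  rw [h1] at hinv
  refine eq_inv_of_mul_eq_one_left ?_
  rw [← integral_mul_const]
  have : cexp c * cexp (-(c:ℂ)) = 1 := by rw [← Complex.exp_add]; simp
  rw [← this, ← hinv, ← integral_const_mul]
  congr 1 with ξ
  simp only [smul_eq_mul]
  rw [← mul_assoc, ← mul_assoc, ← Complex.exp_add]
  congr 3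
  simp [sLine]

lemma sector_iff (α : ℝ) (hα : 0 < α) (hα1 : α ≤ 1) (z : ℂ) : z ∈ Sector α ↔
    (0 < z.re * Real.cos ((1-α)*Real.pi/2) - z.im * Real.sin ((1-α)*Real.pi/2) ∧
     0 < z.re * Real.cos ((1-α)*Real.pi/2) + z.im * Real.sin ((1-α)*Real.pi/2)) := by
  set φ := (1-α)*Real.pi/2 with hφ
  have hpi := Real.pi_pos
  have hφ0 : 0 ≤ φ := by rw [hφ]; have : 0 ≤ 1 - α := by linarith
                         positivity
  have hφ1 : φ < Real.pi/2 := by rw [hφ]; nlinarith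
  have hαφ : α * Real.pi / 2 = Real.pi/2 - φ := by rw [hφ]; ring
  by_cases hz : z = 0
  · subst hz; simp [Sector]
  have hn : 0 < ‖z‖ := norm_pos_iff.2 hz
  have e1 : z.re * Real.cos φ - z.im * Real.sin φ = ‖z‖ * Real.cos (arg z + φ) := by
    rw [Real.cos_add, mul_sub, ← mul_assoc, ← mul_assoc, Complex.norm_mul_cos_arg,
      Complex.norm_mul_sin_arg]
  have e2 : z.re * Real.cos φ + z.im * Real.sin φ = ‖z‖ * Real.cos (arg z - φ) := by
    rw [Real.cos_sub, mul_add, ← mul_assoc, ← mul_assoc, Complex.norm_mul_cos_arg,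
      Complex.norm_mul_sin_arg]
  rw [e1, e2, mul_pos_iff_of_pos_left hn, mul_pos_iff_of_pos_left hn]
  simp only [Sector, Set.mem_setOf_eq, hαφ, abs_lt]
  have ha1 := Complex.neg_pi_lt_arg z
  have ha2 := Complex.arg_le_pi z
  constructor
  · rintro ⟨-, h1, h2⟩
    exact ⟨Real.cos_pos_of_mem_Ioo ⟨by linarith, by linarith⟩,
      Real.cos_pos_of_mem_Ioo ⟨by linarith, by linarith⟩⟩
  · rintro ⟨h1, h2⟩
    refine ⟨hz, ?_, ?_⟩
    · by_contra hcon
      have := Real.cos_nonpos_of_pi_div_two_le_of_le (x := -(arg z - φ)) (by linarith)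
        (by linarith)
      rw [Real.cos_neg] at this
      linarith
    · by_contra hcon
      have := Real.cos_nonpos_of_pi_div_two_le_of_le (x := arg z + φ) (by linarith) (by linarith)
      linarith

lemma sector_open (α : ℝ) (hα : 0 < α) (hα1 : α ≤ 1) : IsOpen (Sector α) := by
  have : Sector α = {z : ℂ |
      0 < z.re * Real.cos ((1-α)*Real.pi/2) - z.im * Real.sin ((1-α)*Real.pi/2)} ∩
      {z : ℂ | 0 < z.re * Real.cos ((1-α)*Real.pi/2) + z.im * Real.sin ((1-α)*Real.pi/2)} := by
    ext z; exact sector_iff α hα hα1 z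
  rw [this]
  exact (isOpen_lt (by fun_prop) (by fun_prop)).inter (isOpen_lt (by fun_prop) (by fun_prop))

lemma sector_convex (α : ℝ) (hα : 0 < α) (hα1 : α ≤ 1) : Convex ℝ (Sector α) := by
  rw [convex_iff_forall_pos]
  intro x hx y hy a b ha hb hab
  rw [sector_iff α hα hα1] at hx hy ⊢
  simp only [Complex.add_re, Complex.add_im, Complex.real_smul, Complex.re_ofReal_mul,
    Complex.im_ofReal_mul]
  constructor
  · have := mul_pos ha hx.1
    have := mul_pos hb hy.1
    linarith
  · have := mul_pos ha hx.2
    have := mul_pos hb hy.2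
    linarith

lemma sector_pos (α : ℝ) (hα : 0 < α) (t : ℝ) (ht : 0 < t) : (t:ℂ) ∈ Sector α := by
  refine ⟨by exact_mod_cast ht.ne', ?_⟩
  rw [Complex.arg_ofReal_of_nonneg ht.le]
  have := Real.pi_pos
  simp; positivity

lemma sector_mul (α : ℝ) (t : ℝ) (ht : 0 < t) (z : ℂ) (hz : z ∈ Sector α) :
    (t:ℂ) * z ∈ Sector α := by
  refine ⟨mul_ne_zero (by exact_mod_cast ht.ne') hz.1, ?_⟩
  rw [Complex.arg_real_mul _ ht]
  exact hz.2

lemma sector_lower (α : ℝ) (hα : 0 < α) (hα1 : α ≤ 1) (z : ℂ) (hz : z ∈ Sector α)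
    (c : ℝ) (hc : 0 < c) (s : ℂ) (hs : s.re = c) :
    c ^ (2 - α) ≤ ‖s ^ ((2 - α : ℝ) : ℂ) + z‖ := by
  have hs0 : s ≠ 0 := by intro h; rw [h] at hs; simp at hs; linarith
  have hpi := Real.pi_pos
  set u : ℂ := s ^ ((1 - α : ℝ) : ℂ) with hu
  have hsu : s ^ ((2 - α : ℝ) : ℂ) = s * u := by
    rw [hu, show (((2 - α : ℝ)) : ℂ) = 1 + ((1 - α : ℝ) : ℂ) by push_cast; ring,
      Complex.cpow_add _ _ hs0, Complex.cpow_one]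
  have hun : ‖u‖ = ‖s‖ ^ (1 - α) := Complex.norm_cpow_real _ _
  have hu0 : 0 < ‖u‖ := by rw [hun]; exact Real.rpow_pos_of_pos (norm_pos_iff.2 hs0) _
  have hcs : c ≤ ‖s‖ := hs ▸ Complex.re_le_norm s
  have hcu : c ^ (1 - α) ≤ ‖u‖ := by
    rw [hun]; exact Real.rpow_le_rpow hc.le hcs (by linarith)
  have hsarg : |arg s| ≤ Real.pi/2 := Complex.abs_arg_le_pi_div_two_iff.2 (by linarith)
  have hur : u.re = ‖u‖ * Real.cos ((1-α) * arg s) := by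
    rw [hun, hu, Complex.cpow_ofReal_re]; ring_nf
  have hui : u.im = ‖u‖ * Real.sin ((1-α) * arg s) := by
    rw [hun, hu, Complex.cpow_ofReal_im]; ring_nf
  have hzu : 0 ≤ (z * (starRingEnd ℂ) u).re := by
    have : (z * (starRingEnd ℂ) u).re = ‖z‖ * ‖u‖ * Real.cos (arg z - (1-α) * arg s) := by
      rw [Complex.mul_re, Complex.conj_re, Complex.conj_im, hur, hui, Real.cos_sub]
      conv_lhs => rw [← Complex.norm_mul_cos_arg z, ← Complex.norm_mul_sin_arg z]
      ring
    rw [this]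
    have h2 := hz.2
    rw [abs_lt] at h2
    rw [abs_le] at hsarg
    have : 0 ≤ 1 - α := by linarith
    have := Real.cos_nonneg_of_mem_Icc (x := arg z - (1-α) * arg s)
      ⟨by nlinarith, by nlinarith⟩
    positivity
  have hre : ((s * u + z) * (starRingEnd ℂ) u).re = c * ‖u‖^2 + (z * (starRingEnd ℂ) u).re := by
    rw [add_mul, Complex.add_re, mul_assoc, Complex.mul_conj, Complex.normSq_eq_norm_sq,
      Complex.re_mul_ofReal, hs]
  have hle := Complex.re_le_norm ((s * u + z) * (starRingEnd ℂ) u)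
  rw [hre, norm_mul, RCLike.norm_conj] at hle
  have h3 : c * ‖u‖ ≤ ‖s * u + z‖ := by
    by_contra hcon
    push Not at hcon
    nlinarith
  rw [hsu, show 2 - α = 1 + (1 - α) by ring, Real.rpow_add hc, Real.rpow_one]
  exact (mul_le_mul_of_nonneg_left hcu hc.le).trans h3

lemma thick_lower (α : ℝ) (hα : 0 < α) (hα1 : α ≤ 1) (c : ℝ) (hc : 1 ≤ c) (z : ℂ)
    (hz : z ∈ Metric.thickening (c ^ (2-α) / 2) (Sector α)) (ξ : ℝ) :
    c ^ (2-α) / 2 ≤ ‖(sLine c ξ) ^ ((2 - α : ℝ) : ℂ) + z‖ := by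
  obtain ⟨w, hw, hd⟩ := Metric.mem_thickening_iff.1 hz
  have := sector_lower α hα hα1 w hw c (by linarith) (sLine c ξ) (sLine_re c ξ)
  rw [dist_eq_norm, norm_sub_rev] at hd
  have h3 := norm_add_le ((sLine c ξ) ^ ((2 - α : ℝ) : ℂ) + z) (w - z)
  rw [add_add_sub_cancel] at h3
  linarith

/-- The contour integral. -/
def FF (α c : ℝ) (z : ℂ) : ℂ := ∫ ξ : ℝ, cexp (sLine c ξ) * (sLine c ξ) ^ (-((2:ℝ):ℂ)) *
  ((sLine c ξ) ^ ((2 - α : ℝ) : ℂ) + z)⁻¹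

lemma kern_norm (c : ℝ) (hc : 1 ≤ c) (ξ : ℝ) :
    ‖cexp (sLine c ξ) * (sLine c ξ) ^ (-((2:ℝ):ℂ))‖ ≤ Real.exp c * (1 + ξ^2)⁻¹ := by
  rw [norm_mul, Complex.norm_exp, sLine_re]
  have := sLine_cpow_norm c hc 2 le_rfl ξ
  simp only [sub_self, Real.rpow_zero, one_mul] at this
  gcongr

lemma kern_cont (c : ℝ) (hc : 1 ≤ c) :
    Continuous fun ξ => cexp (sLine c ξ) * (sLine c ξ) ^ (-((2:ℝ):ℂ)) :=
  (Complex.continuous_exp.comp (sLine_cont c)).mul (sLine_cpow_cont c hc _)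

lemma FF_integrand_meas (α c : ℝ) (hc : 1 ≤ c) (z : ℂ) (n : ℕ) :
    AEStronglyMeasurable (fun ξ : ℝ => cexp (sLine c ξ) * (sLine c ξ) ^ (-((2:ℝ):ℂ)) *
      (((sLine c ξ) ^ ((2 - α : ℝ) : ℂ) + z)⁻¹)^n) volume := by
  refine (kern_cont c hc).aestronglyMeasurable.mul ?_
  have : Continuous (fun ξ : ℝ => (sLine c ξ) ^ ((2 - α : ℝ) : ℂ) + z) :=
    (sLine_cpow_cont c hc _).add continuous_const
  exact (this.measurable.inv.pow_const n).aestronglyMeasurable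

lemma FF_bound (α : ℝ) (hα : 0 < α) (hα1 : α ≤ 1) (c : ℝ) (hc : 1 ≤ c) (z : ℂ)
    (hz : z ∈ Metric.thickening (c ^ (2-α) / 2) (Sector α)) (n : ℕ) (ξ : ℝ) :
    ‖cexp (sLine c ξ) * (sLine c ξ) ^ (-((2:ℝ):ℂ)) *
      (((sLine c ξ) ^ ((2 - α : ℝ) : ℂ) + z)⁻¹)^n‖ ≤
      (Real.exp c * 2^n) * (1 + ξ^2)⁻¹ := by
  rw [norm_mul, norm_pow, norm_inv]
  have h1 := kern_norm c hc ξ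
  have h2 := thick_lower α hα hα1 c hc z hz ξ
  have h3 : 1 ≤ c ^ (2-α) := Real.one_le_rpow hc (by linarith)
  have h4 : ‖(sLine c ξ) ^ ((2 - α : ℝ) : ℂ) + z‖⁻¹ ≤ 2 := by
    rw [inv_le_comm₀ (by linarith) (by norm_num)]; linarith
  calc _ ≤ Real.exp c * (1 + ξ^2)⁻¹ * 2^n := by gcongr
    _ = _ := by ring

lemma FF_diff (α : ℝ) (hα : 0 < α) (hα1 : α ≤ 1) (c : ℝ) (hc : 1 ≤ c) (z : ℂ)
    (hz : z ∈ Metric.thickening (c ^ (2-α) / 2) (Sector α)) : DifferentiableAt ℂ (FF α c) z := by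
  have hU : Metric.thickening (c ^ (2-α) / 2) (Sector α) ∈ 𝓝 z :=
    Metric.isOpen_thickening.mem_nhds hz
  unfold FF
  refine (hasDerivAt_integral_of_dominated_loc_of_deriv_le
    (F' := fun w ξ => -(cexp (sLine c ξ) * (sLine c ξ) ^ (-((2:ℝ):ℂ)) *
      (((sLine c ξ) ^ ((2 - α : ℝ) : ℂ) + w)⁻¹)^2))
    (bound := fun ξ => (Real.exp c * 2^2) * (1 + ξ^2)⁻¹) hU
    (Eventually.of_forall fun w => by simpa using FF_integrand_meas α c hc w 1) ?_ ?_ ?_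
    (integrable_inv_one_add_sq.const_mul _) ?_).2.differentiableAt
  · refine (integrable_inv_one_add_sq.const_mul (Real.exp c * 2^1)).mono'
      (by simpa using FF_integrand_meas α c hc z 1) (Eventually.of_forall fun ξ => ?_)
    simpa only [pow_one] using FF_bound α hα hα1 c hc z hz 1 ξ
  · exact (FF_integrand_meas α c hc z 2).neg
  · refine Eventually.of_forall fun ξ w hw => ?_
    rw [norm_neg]
    exact FF_bound α hα hα1 c hc w hw 2 ξ
  · refine Eventually.of_forall fun ξ w hw => ?_
    have h2 := thick_lower α hα hα1 c hc w hw ξ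
    have h3 : 1 ≤ c ^ (2-α) := Real.one_le_rpow hc (by linarith)
    have hne : (sLine c ξ) ^ ((2 - α : ℝ) : ℂ) + w ≠ 0 := norm_pos_iff.1 (by linarith)
    have := ((((hasDerivAt_id w).const_add ((sLine c ξ) ^ ((2 - α : ℝ) : ℂ))).fun_inv hne).const_mul
      (cexp (sLine c ξ) * (sLine c ξ) ^ (-((2:ℝ):ℂ))))
    refine this.congr_deriv ?_
    simp only [id]
    field_simp

lemma FF_norm (α : ℝ) (hα : 0 < α) (hα1 : α ≤ 1) (c : ℝ) (hc : 1 ≤ c) (z : ℂ)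
    (hz : z ∈ Metric.thickening (c ^ (2-α) / 2) (Sector α)) :
    ‖FF α c z‖ ≤ Real.exp c * (2 * Real.pi) := by
  have := norm_integral_le_of_norm_le (μ := volume)
    (integrable_inv_one_add_sq.const_mul (Real.exp c * 2^1))
    (Eventually.of_forall (FF_bound α hα hα1 c hc z hz 1))
  rw [integral_const_mul, integral_univ_inv_one_add_sq] at this
  simp only [pow_one] at this
  unfold FF
  linarith

/-- Coefficients. -/
def aa (α : ℝ) (j : ℕ) : ℂ := (-1:ℂ) ^ j / ((Real.Gamma ((2 - α) * ((j:ℝ) + 1) + 2) : ℝ) : ℂ)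

/-- The Mittag-Leffler type function. -/
def EE (α : ℝ) (z : ℂ) : ℂ :=
  ∑' j : ℕ, ((-1:ℂ) ^ j * z ^ j) / ((Real.Gamma ((2 - α) * ((j:ℝ) + 1) + 2) : ℝ) : ℂ)

lemma gam_lower (α : ℝ) (hα1 : α ≤ 1) (j : ℕ) :
    (j.factorial : ℝ) ≤ Real.Gamma ((2 - α) * ((j:ℝ) + 1) + 2) := by
  have h1 : Real.Gamma ((j+2:ℕ) + 1) = ((j+2).factorial : ℝ) := Real.Gamma_nat_eq_factorial _
  have hj : (0:ℝ) ≤ j := by positivity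
  have h2 : Real.Gamma (((j+2:ℕ):ℝ) + 1) ≤ Real.Gamma ((2 - α) * ((j:ℝ) + 1) + 2) := by
    apply Real.Gamma_strictMonoOn_Ici.monotoneOn
    · simp; linarith
    · simp only [Set.mem_Ici]; nlinarith
    · push_cast; nlinarith
  rw [h1] at h2
  refine le_trans ?_ h2
  exact_mod_cast Nat.factorial_le (by omega)

lemma aa_norm (α : ℝ) (hα1 : α ≤ 1) (j : ℕ) :
    ‖aa α j‖ = (Real.Gamma ((2 - α) * ((j:ℝ) + 1) + 2))⁻¹ := by
  have := gam_lower α hα1 j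
  have h0 : (0:ℝ) < j.factorial := by positivity
  rw [aa, norm_div, norm_pow, norm_neg, norm_one, one_pow, Complex.norm_real,
    Real.norm_of_nonneg (by linarith), one_div]

lemma EE_fps (α : ℝ) (hα1 : α ≤ 1) :
    HasFPowerSeriesOnBall (EE α) (FormalMultilinearSeries.ofScalars ℂ (aa α)) 0 ⊤ := by
  have hr : (FormalMultilinearSeries.ofScalars ℂ (aa α)).radius = ⊤ := by
    apply FormalMultilinearSeries.radius_eq_top_of_summable_norm
    intro r
    refine Summable.of_nonneg_of_le (fun n => by positivity) (fun n => ?_)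
      (Real.summable_pow_div_factorial r)
    rw [FormalMultilinearSeries.ofScalars_norm, aa_norm α hα1, div_eq_inv_mul]
    gcongr
    exact gam_lower α hα1 n
  have := (FormalMultilinearSeries.ofScalars ℂ (aa α)).hasFPowerSeriesOnBall (by rw [hr]; simp)
  rw [hr] at this
  convert this using 1
  ext z
  change EE α z = FormalMultilinearSeries.ofScalarsSum (aa α) z
  rw [FormalMultilinearSeries.ofScalars_sum_eq, EE]
  congr 1 with j
  simp only [aa, smul_eq_mul]; ring

lemma EE_diff (α : ℝ) (hα1 : α ≤ 1) : Differentiable ℂ (EE α) := by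
  have := (EE_fps α hα1).differentiableOn
  simpa [differentiableOn_univ] using this

lemma EE_iter (α : ℝ) (hα1 : α ≤ 1) (j : ℕ) :
    iteratedDeriv j (EE α) 0 = j.factorial * aa α j := by
  have h1 := (EE_fps α hα1).hasFPowerSeriesAt
  have h2 := h1.analyticAt.hasFPowerSeriesAt
  have h3 := h1.eq_formalMultilinearSeries h2
  have h4 := congrArg (fun p => FormalMultilinearSeries.coeff p j) h3
  simp only [FormalMultilinearSeries.coeff_ofScalars] at h4
  rw [h4]
  have : (j.factorial : ℂ) ≠ 0 := by exact_mod_cast j.factorial_ne_zero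
  field_simp

lemma cpow_term (α c : ℝ) (hc : 1 ≤ c) (ξ : ℝ) (j : ℕ) :
    (sLine c ξ) ^ (-(((2 - α) * ((j:ℝ) + 1) + 2 : ℝ) : ℂ)) =
    (sLine c ξ) ^ (-((2:ℝ):ℂ)) * ((sLine c ξ) ^ ((2 - α : ℝ) : ℂ))⁻¹ ^ (j+1) := by
  have h0 := sLine_ne c ξ hc
  rw [show (-(((2 - α) * ((j:ℝ) + 1) + 2 : ℝ) : ℂ)) =
    -((2:ℝ):ℂ) + -(((j+1:ℕ):ℂ) * ((2 - α : ℝ) : ℂ)) by push_cast; ring,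
    Complex.cpow_add _ _ h0, Complex.cpow_neg _ (((j+1:ℕ):ℂ) * _), Complex.cpow_nat_mul, inv_pow]

lemma EE_eq_near (α : ℝ) (hα1 : α ≤ 1) (c : ℝ) (hc : 1 ≤ c) (z : ℂ) (hz : ‖z‖ < 1) :
    EE α z = FF α c z := by
  have hb : ∀ j : ℕ, 2 ≤ (2 - α) * ((j:ℝ) + 1) + 2 := by
    intro j
    have hj : (0:ℝ) ≤ j := by positivity
    nlinarith
  set F : ℕ → ℝ → ℂ := fun j ξ => ((-1:ℂ)^j * z^j) *
    (cexp (sLine c ξ) * (sLine c ξ) ^ (-(((2 - α) * ((j:ℝ) + 1) + 2 : ℝ) : ℂ))) with hF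
  have hFn : ∀ j ξ, ‖F j ξ‖ ≤ (‖z‖^j * Real.exp c) * (1 + ξ^2)⁻¹ := by
    intro j ξ
    simp only [hF]
    rw [norm_mul, norm_mul, norm_mul, norm_pow, norm_pow, norm_neg, norm_one, one_pow, one_mul,
      Complex.norm_exp, sLine_re, mul_assoc]
    gcongr
    refine (sLine_cpow_norm c hc _ (hb j) ξ).trans ?_
    have : c ^ (2 - ((2 - α) * ((j:ℝ) + 1) + 2)) ≤ 1 :=
      Real.rpow_le_one_of_one_le_of_nonpos hc (by linarith [hb j])
    have h0 : 0 ≤ (1 + ξ^2)⁻¹ := by positivity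
    nlinarith
  have hFi : ∀ j, Integrable (F j) := by
    intro j
    refine (integrable_inv_one_add_sq.const_mul (‖z‖^j * Real.exp c)).mono' ?_
      (Eventually.of_forall (hFn j))
    exact (continuous_const.mul ((Complex.continuous_exp.comp (sLine_cont c)).mul
      (sLine_cpow_cont c hc _))).aestronglyMeasurable
  have hsum : Summable fun j => ∫ ξ, ‖F j ξ‖ := by
    refine Summable.of_nonneg_of_le (fun j => integral_nonneg fun ξ => norm_nonneg _)
      (fun j => ?_) ((summable_geometric_of_lt_one (norm_nonneg z) hz).mul_right
        (Real.exp c * Real.pi))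
    calc _ ≤ ∫ ξ : ℝ, (‖z‖^j * Real.exp c) * (1 + ξ^2)⁻¹ :=
          integral_mono (hFi j).norm (integrable_inv_one_add_sq.const_mul _) (hFn j)
      _ = _ := by rw [integral_const_mul, integral_univ_inv_one_add_sq]; ring
  have hS := (hasSum_integral_of_summable_integral_norm hFi hsum).tsum_eq
  have h1 : EE α z = ∑' j, ∫ ξ, F j ξ := by
    unfold EE
    congr 1 with j
    simp only [hF]
    rw [integral_const_mul, x_bromwich c hc _ (hb j), div_eq_mul_inv]
  rw [h1, hS, FF]
  congr 1 with ξ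
  set q := (sLine c ξ) ^ ((2 - α : ℝ) : ℂ) with hq
  have hqn : 1 ≤ ‖q‖ := by
    rw [hq, Complex.norm_cpow_real]
    exact Real.one_le_rpow (hc.trans (sLine_norm_ge c ξ hc)) (by linarith)
  have hq0 : q ≠ 0 := norm_pos_iff.1 (by linarith)
  have hlt : ‖-z * q⁻¹‖ < 1 := by
    rw [norm_mul, norm_neg, norm_inv]
    have : ‖q‖⁻¹ ≤ 1 := inv_le_one_of_one_le₀ hqn
    nlinarith [norm_nonneg z]
  have hqz : q + z ≠ 0 := by
    intro h
    have : q = -z := by linear_combination h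
    rw [this, norm_neg] at hqn
    linarith
  have : ∀ j, F j ξ = (cexp (sLine c ξ) * (sLine c ξ) ^ (-((2:ℝ):ℂ)) * q⁻¹) * (-z * q⁻¹)^j := by
    intro j
    simp only [hF]
    rw [cpow_term α c hc ξ j, ← hq, mul_pow, neg_pow z]
    ring
  simp_rw [this]
  rw [tsum_mul_left, tsum_geometric_of_norm_lt_one hlt]
  have h5 : 1 - -z * q⁻¹ = (q + z) * q⁻¹ := by field_simp; ring
  rw [h5, mul_inv, inv_inv]
  field_simp

lemma EE_bound (α : ℝ) (hα : 0 < α) (hα1 : α ≤ 1) (c : ℝ) (hc : 1 ≤ c) (z : ℂ)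
    (hz : z ∈ Metric.thickening (c ^ (2-α) / 2) (Sector α)) :
    ‖EE α z‖ ≤ Real.exp c * (2 * Real.pi) := by
  have h3 : 1 ≤ c ^ (2-α) := Real.one_le_rpow hc (by linarith)
  have hU : IsOpen (Metric.thickening (c ^ (2-α) / 2) (Sector α)) := Metric.isOpen_thickening
  have h0 : (0:ℂ) ∈ Metric.thickening (c ^ (2-α) / 2) (Sector α) := by
    rw [Metric.mem_thickening_iff]
    refine ⟨((1/4:ℝ):ℂ), sector_pos α hα _ (by norm_num), ?_⟩
    rw [dist_eq_norm, zero_sub, norm_neg, Complex.norm_real, Real.norm_of_nonneg (by norm_num)]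
    linarith
  have heq := AnalyticOnNhd.eqOn_of_preconnected_of_eventuallyEq (𝕜 := ℂ) (f := EE α)
    (g := FF α c)
    ((Complex.analyticOnNhd_iff_differentiableOn hU).2 (EE_diff α hα1).differentiableOn)
    ((Complex.analyticOnNhd_iff_differentiableOn hU).2 fun w hw =>
      (FF_diff α hα hα1 c hc w hw).differentiableWithinAt)
    ((sector_convex α hα hα1).thickening _).isPreconnected h0 (by
      filter_upwards [Metric.ball_mem_nhds (0:ℂ) one_pos] with w hw
      exact EE_eq_near α hα1 c hc w (by simpa using hw))
  rw [heq hz]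
  exact FF_norm α hα hα1 c hc z hz

lemma EE_iter_bound (α : ℝ) (hα : 0 < α) (hα1 : α ≤ 1) (j : ℕ) (z : ℂ) (hz : z ∈ Sector α) :
    ‖iteratedDeriv j (EE α) z‖ * Gbar (1 - α) j ≤
      (Real.exp 1 * (2 * Real.pi)) * (4 * Real.exp 1) ^ j := by
  set c : ℝ := max (j:ℝ) 1 with hcdef
  have hc : 1 ≤ c := le_max_right _ _
  have h3 : 1 ≤ c ^ (2-α) := Real.one_le_rpow hc (by linarith)
  have hC := Complex.norm_iteratedDeriv_le_of_forall_mem_sphere_norm_le (f := EE α) (c := z)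
    (R := c ^ (2-α) / 4) (C := Real.exp c * (2 * Real.pi)) j (by linarith)
    (EE_diff α hα1).diffContOnCl (fun w hw => EE_bound α hα hα1 c hc w (by
      rw [Metric.mem_thickening_iff]
      refine ⟨z, hz, ?_⟩
      rw [Metric.mem_sphere.1 hw]; linarith))
  have hG0 : 0 ≤ Gbar (1 - α) j := by unfold Gbar; positivity
  refine (mul_le_mul_of_nonneg_right hC hG0).trans ?_
  have hexp : Real.exp c ≤ Real.exp 1 * Real.exp 1 ^ j := by
    rw [← Real.exp_nat_mul, ← Real.exp_add]
    apply Real.exp_le_exp.2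
    rw [hcdef]
    have hj : (0:ℝ) ≤ j := by positivity
    apply max_le <;> linarith
  have hkey : (j.factorial : ℝ) * Gbar (1-α) j ≤ (c ^ (2-α)) ^ j := by
    rcases Nat.eq_zero_or_pos j with rfl | hj
    · simp [Gbar]
    have hj1 : (1:ℝ) ≤ j := by exact_mod_cast hj
    have hcj : c = j := max_eq_left hj1
    have hf : (j.factorial : ℝ) ≤ (j:ℝ)^j := by exact_mod_cast Nat.factorial_le_pow j
    calc _ ≤ (j:ℝ)^j * Gbar (1-α) j := by gcongr
      _ = _ := by
        have hj0 : (0:ℝ) < j := by linarith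
        rw [hcj, Gbar, ← Real.rpow_natCast, ← Real.rpow_natCast, ← Real.rpow_mul hj0.le,
          ← Real.rpow_add hj0]
        congr 1; ring
  have hcp : 0 < (c ^ (2-α)) ^ j := by positivity
  rw [div_pow, div_div_eq_mul_div, div_mul_eq_mul_div, div_le_iff₀ hcp, mul_pow]
  calc _ = (j.factorial * Gbar (1-α) j) * (Real.exp c * (2 * Real.pi) * 4^j) := by ring
    _ ≤ (c ^ (2-α)) ^ j * ((Real.exp 1 * Real.exp 1 ^ j) * (2 * Real.pi) * 4^j) := by gcongr
    _ = _ := by ring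

lemma fact_b (j : ℕ) : (2*j+3).factorial ≤ 6 * 20^j * j.factorial^2 := by
  induction j with
  | zero => simp [Nat.factorial]
  | succ j ih =>
    have : (2*(j+1)+3).factorial = (2*j+5)*((2*j+4) * (2*j+3).factorial) := rfl
    rw [this, Nat.factorial_succ j]
    calc _ ≤ (2*j+5)*((2*j+4) * (6 * 20^j * j.factorial^2)) :=
          Nat.mul_le_mul_left _ (Nat.mul_le_mul_left _ ih)
      _ = ((2*j+5)*(2*j+4)) * (6 * 20^j * j.factorial^2) := by ring
      _ ≤ (20 * (j+1)^2) * (6 * 20^j * j.factorial^2) := by gcongr ?_ * _; nlinarith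
      _ = _ := by ring

lemma fact_a (j : ℕ) : (j+2).factorial ≤ 2 * 3^j * j.factorial := by
  induction j with
  | zero => simp [Nat.factorial]
  | succ j ih =>
    have : (j+1+2).factorial = (j+3)*(j+2).factorial := rfl
    rw [this, Nat.factorial_succ j]
    calc _ ≤ (j+3) * (2 * 3^j * j.factorial) := Nat.mul_le_mul_left _ ih
      _ ≤ (3*(j+1)) * (2 * 3^j * j.factorial) := by gcongr ?_ * _; omega
      _ = _ := by ring

lemma gam_upper (α : ℝ) (hα : 0 < α) (hα1 : α ≤ 1) (j : ℕ) :
    Real.Gamma ((2 - α) * ((j:ℝ) + 1) + 2) ≤ 6 * 20^j * (j.factorial * Gbar (1 - α) j) := by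
  have hfpos : (0:ℝ) < j.factorial := by positivity
  have hA : Real.Gamma ((j:ℝ)+3) ≤ 6 * 20^j * j.factorial := by
    have h1 : Real.Gamma ((j+2:ℕ) + 1) = ((j+2).factorial : ℝ) := Real.Gamma_nat_eq_factorial _
    have h2 : ((j+2).factorial : ℝ) ≤ 2 * 3^j * j.factorial := by exact_mod_cast fact_a j
    rw [show (j:ℝ) + 3 = ((j+2:ℕ):ℝ) + 1 by push_cast; ring, h1]
    refine h2.trans ?_
    gcongr <;> norm_num
  have hB : Real.Gamma (2*(j:ℝ)+4) ≤ 6 * 20^j * j.factorial^2 := by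
    have h1 : Real.Gamma ((2*j+3:ℕ) + 1) = ((2*j+3).factorial : ℝ) :=
      Real.Gamma_nat_eq_factorial _
    rw [show 2*(j:ℝ) + 4 = ((2*j+3:ℕ):ℝ) + 1 by push_cast; ring, h1]
    exact_mod_cast fact_b j
  rcases hα1.eq_or_lt with rfl | hlt
  · rw [show (2 - (1:ℝ)) * ((j:ℝ) + 1) + 2 = j + 3 by ring]
    simpa [Gbar] using hA
  have hj : (0:ℝ) ≤ j := by positivity
  have h := Real.Gamma_mul_add_mul_le_rpow_Gamma_mul_rpow_Gamma (s := (j:ℝ)+3) (t := 2*(j:ℝ)+4)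
    (a := α) (b := 1 - α) (by linarith) (by linarith) hα (by linarith) (by ring)
  rw [show α * ((j:ℝ) + 3) + (1 - α) * (2 * j + 4) = (2 - α) * ((j:ℝ) + 1) + 2 by ring] at h
  have hG1 : 0 ≤ Real.Gamma ((j:ℝ)+3) := (Real.Gamma_pos_of_pos (by linarith)).le
  have hG2 : 0 ≤ Real.Gamma (2*(j:ℝ)+4) := (Real.Gamma_pos_of_pos (by linarith)).le
  have h0 : 0 ≤ 1 - α := by linarith
  have hK : (0:ℝ) < 6 * 20^j := by positivity
  have hf : (j.factorial : ℝ) ≤ (j:ℝ)^j := by exact_mod_cast Nat.factorial_le_pow j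
  have hfG : (j.factorial : ℝ) ^ (1-α) ≤ Gbar (1-α) j := by
    refine (Real.rpow_le_rpow hfpos.le hf h0).trans (le_of_eq ?_)
    rw [Gbar, ← Real.rpow_natCast, ← Real.rpow_mul hj, mul_comm]
  calc _ ≤ _ := h
    _ ≤ (6 * 20^j * j.factorial)^α * (6 * 20^j * (j.factorial:ℝ)^2)^(1-α) := by gcongr
    _ = 6 * 20^j * (j.factorial * (j.factorial:ℝ) ^ (1-α)) := by
      rw [show (6 * 20^j * (j.factorial:ℝ)^2) = (6 * 20^j * j.factorial) * j.factorial by ring,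
        Real.mul_rpow (x := 6 * 20^j * j.factorial) (by positivity) hfpos.le, ← mul_assoc,
        ← Real.rpow_add (by positivity)]
      rw [show α + (1 - α) = 1 by ring, Real.rpow_one]
      ring
    _ ≤ _ := by gcongr

lemma gbar_pos (s : ℝ) (j : ℕ) : 0 < Gbar s j := by
  rcases Nat.eq_zero_or_pos j with rfl | hj
  · simp [Gbar]
  · have : (0:ℝ) < j := by exact_mod_cast hj
    unfold Gbar; positivity

section logconvex
variable (L : ℕ → ℝ) (hLpos : ∀ j, 0 < L j) (hLlc : IsLogConvexSeq L)

lemma quot_pos (L : ℕ → ℝ) (hLpos : ∀ j, 0 < L j) (n : ℕ) : 0 < quotSeq L n :=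
  div_pos (hLpos _) (hLpos _)

lemma quot_step (L : ℕ → ℝ) (hLpos : ∀ j, 0 < L j) (n : ℕ) : L (n+1) = L n * quotSeq L n := by
  rw [quotSeq, mul_div_cancel₀ _ (hLpos n).ne']

lemma quot_mono (L : ℕ → ℝ) (hLpos : ∀ j, 0 < L j) (hLlc : IsLogConvexSeq L) :
    Monotone (quotSeq L) := by
  refine monotone_nat_of_le_succ fun n => ?_
  rw [quotSeq, quotSeq, div_le_div_iff₀ (hLpos _) (hLpos _)]
  have := hLlc n
  nlinarith

lemma lc_ineq (L : ℕ → ℝ) (hLpos : ∀ j, 0 < L j) (hLlc : IsLogConvexSeq L) (n j : ℕ) :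
    L n * quotSeq L n ^ j ≤ L j * quotSeq L n ^ n := by
  have hq := quot_pos L hLpos n
  have hup : ∀ k, L n * quotSeq L n ^ (n + k) ≤ L (n + k) * quotSeq L n ^ n := by
    intro k
    induction k with
    | zero => simp
    | succ k ih =>
      rw [← add_assoc, pow_succ, quot_step L hLpos]
      have h1 := quot_mono L hLpos hLlc (Nat.le_add_right n k)
      have h2 : 0 < L (n+k) * quotSeq L n ^ n := mul_pos (hLpos _) (pow_pos hq _)
      nlinarith
  have hdown : ∀ k j, j + k = n → L n * quotSeq L n ^ j ≤ L j * quotSeq L n ^ n := by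
    intro k
    induction k with
    | zero => intro j hj; simp at hj; subst hj; rfl
    | succ k ih =>
      intro j hj
      have := ih (j+1) (by omega)
      rw [pow_succ, quot_step L hLpos] at this
      have h1 := quot_mono L hLpos hLlc (show j ≤ n by omega)
      have h2 : 0 < L j * quotSeq L n ^ n := mul_pos (hLpos _) (pow_pos hq _)
      refine le_of_mul_le_mul_right ?_ hq
      nlinarith
  rcases le_total n j with h | h
  · obtain ⟨k, rfl⟩ := Nat.exists_eq_add_of_le h
    exact hup k
  · exact hdown (n - j) j (by omega)

lemma coef_pos (L : ℕ → ℝ) (hLpos : ∀ j, 0 < L j) (n : ℕ) : 0 < coefT L n := by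
  have := quot_pos L hLpos n
  have := hLpos n
  have := hLpos (n+1)
  unfold coefT; positivity

lemma coef_le (L : ℕ → ℝ) (hLpos : ∀ j, 0 < L j) (hLlc : IsLogConvexSeq L) (n j : ℕ) :
    coefT L n * quotSeq L n ^ j ≤ (1/2)^n * L j := by
  have hq := quot_pos L hLpos n
  have h := lc_ineq L hLpos hLlc n j
  change (1/2:ℝ)^n * (L n / quotSeq L n ^ n) * quotSeq L n ^ j ≤ _
  rw [mul_assoc]
  gcongr
  rw [div_mul_eq_mul_div, div_le_iff₀ (pow_pos hq _)]
  exact h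

lemma coef_self (L : ℕ → ℝ) (hLpos : ∀ j, 0 < L j) (j : ℕ) :
    coefT L j * quotSeq L j ^ j = (1/2)^j * L j := by
  have hq := (pow_pos (quot_pos L hLpos j) j).ne'
  change (1/2:ℝ)^j * (L j / quotSeq L j ^ j) * quotSeq L j ^ j = _
  field_simp

end logconvex

/-- Term of the differentiated series. -/
def hh (α : ℝ) (L : ℕ → ℝ) (k n : ℕ) (z : ℂ) : ℂ :=
  ((coefT L n * quotSeq L n ^ k : ℝ) : ℂ) * iteratedDeriv k (EE α) ((quotSeq L n : ℂ) * z)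

/-- Derivative bound constants. -/
def BB (α : ℝ) (k : ℕ) : ℝ :=
  (Real.exp 1 * (2 * Real.pi)) * (4 * Real.exp 1) ^ k / Gbar (1 - α) k

lemma EE_iter_bound' (α : ℝ) (hα : 0 < α) (hα1 : α ≤ 1) (k : ℕ) (z : ℂ) (hz : z ∈ Sector α) :
    ‖iteratedDeriv k (EE α) z‖ ≤ BB α k := by
  rw [BB, le_div_iff₀ (gbar_pos _ _)]
  exact EE_iter_bound α hα hα1 k z hz

lemma BB_nonneg (α : ℝ) (k : ℕ) : 0 ≤ BB α k := by
  have := gbar_pos (1-α) k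
  have := Real.pi_pos
  unfold BB; positivity

lemma hh_bound (α : ℝ) (hα : 0 < α) (hα1 : α ≤ 1) (L : ℕ → ℝ) (hLpos : ∀ j, 0 < L j)
    (hLlc : IsLogConvexSeq L) (k n : ℕ) (z : ℂ) (hz : z ∈ Sector α) :
    ‖hh α L k n z‖ ≤ (1/2)^n * (L k * BB α k) := by
  have hq := quot_pos L hLpos n
  have hc := coef_pos L hLpos n
  rw [hh, norm_mul, Complex.norm_real, Real.norm_of_nonneg (by positivity), ← mul_assoc]
  exact mul_le_mul (coef_le L hLpos hLlc n k)
    (EE_iter_bound' α hα hα1 k _ (sector_mul α _ hq z hz)) (norm_nonneg _)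
    (mul_nonneg (by positivity) (hLpos k).le)

lemma hh_diff (α : ℝ) (hα1 : α ≤ 1) (L : ℕ → ℝ) (k n : ℕ) : Differentiable ℂ (hh α L k n) := by
  have h1 : Differentiable ℂ (iteratedDeriv k (EE α)) :=
    ((EE_diff α hα1).contDiff (n := ⊤)).differentiable_iteratedDeriv k (by simp)
  unfold hh
  exact (h1.comp (differentiable_id.const_mul _)).const_mul _

lemma g_iter (α : ℝ) (hα : 0 < α) (hα1 : α ≤ 1) (L : ℕ → ℝ) (k n : ℕ) (z : ℂ)
    (hz : z ∈ Sector α) :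
    iteratedDerivWithin k (fun z => (coefT L n : ℂ) * EE α ((quotSeq L n : ℂ) * z)) (Sector α) z
      = hh α L k n z := by
  rw [iteratedDerivWithin_of_isOpen (sector_open α hα hα1) hz, iteratedDeriv_const_mul_field,
    iteratedDeriv_comp_const_mul (EE_diff α hα1).contDiff, hh]
  push_cast; ring

lemma summable_bd (x : ℝ) : Summable fun n : ℕ => (1/2:ℝ)^n * x :=
  summable_geometric_two.mul_right x

lemma T_iter (α : ℝ) (hα : 0 < α) (hα1 : α ≤ 1) (L : ℕ → ℝ) (hLpos : ∀ j, 0 < L j)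
    (hLlc : IsLogConvexSeq L) (k : ℕ) (z : ℂ) (hz : z ∈ Sector α) :
    iteratedDerivWithin k (Ttrans L (EE α)) (Sector α) z = ∑' n, hh α L k n z := by
  have hS := sector_open α hα hα1
  change iteratedDerivWithin k
    (fun z => ∑' n, (coefT L n : ℂ) * EE α ((quotSeq L n : ℂ) * z)) (Sector α) z = _
  rw [iteratedDerivWithin_tsum k hS hz]
  · congr 1 with n
    exact g_iter α hα hα1 L k n z hz
  · intro t ht
    refine Summable.of_norm_bounded (summable_bd (L 0 * BB α 0)) fun n => ?_
    have := hh_bound α hα hα1 L hLpos hLlc 0 n t ht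
    simpa [hh] using this
  · intro m _ _
    refine SummableLocallyUniformlyOn_of_locally_bounded hS fun K hK _ =>
      ⟨_, summable_bd (L m * BB α m), fun n w hw => ?_⟩
    rw [g_iter α hα hα1 L m n w (hK hw)]
    exact hh_bound α hα hα1 L hLpos hLlc m n w (hK hw)
  · intro n m r _ hr
    refine (hh_diff α hα1 L m n r).congr_of_eventuallyEq ?_
    filter_upwards [hS.mem_nhds hr] with w hw
    exact g_iter α hα hα1 L m n w hw

lemma T_diff (α : ℝ) (hα : 0 < α) (hα1 : α ≤ 1) (L : ℕ → ℝ) (hLpos : ∀ j, 0 < L j)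
    (hLlc : IsLogConvexSeq L) : DifferentiableOn ℂ (Ttrans L (EE α)) (Sector α) := by
  have hS := sector_open α hα hα1
  refine SummableLocallyUniformlyOn.differentiableOn
    (f := fun n z => (coefT L n : ℂ) * EE α ((quotSeq L n : ℂ) * z)) hS ?_ ?_
  · refine SummableLocallyUniformlyOn_of_locally_bounded hS fun K hK _ =>
      ⟨_, summable_bd (L 0 * BB α 0), fun n w hw => ?_⟩
    have := hh_bound α hα hα1 L hLpos hLlc 0 n w (hK hw)
    simpa [hh] using this
  · intro n r _
    exact (((EE_diff α hα1).comp (differentiable_id.const_mul _)).const_mul _) r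

lemma T_bound (α : ℝ) (hα : 0 < α) (hα1 : α ≤ 1) (L : ℕ → ℝ) (hLpos : ∀ j, 0 < L j)
    (hLlc : IsLogConvexSeq L) (k : ℕ) (z : ℂ) (hz : z ∈ Sector α) :
    ‖iteratedDerivWithin k (Ttrans L (EE α)) (Sector α) z‖ ≤ 2 * (L k * BB α k) := by
  rw [T_iter α hα hα1 L hLpos hLlc k z hz]
  exact tsum_of_norm_bounded (hasSum_geometric_two.mul_right _)
    fun n => hh_bound α hα hα1 L hLpos hLlc k n z hz

lemma T_lower (α : ℝ) (hα : 0 < α) (hα1 : α ≤ 1) (L : ℕ → ℝ) (hLpos : ∀ j, 0 < L j)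
    (hLlc : IsLogConvexSeq L) (k : ℕ) (D : ℝ)
    (hD : ∀ z ∈ Sector α, ‖iteratedDerivWithin k (Ttrans L (EE α)) (Sector α) z‖ ≤ D) :
    L k ≤ D * (6 * 40 ^ k * Gbar (1 - α) k) := by
  have htend : Tendsto (fun m : ℕ => ∑' n, hh α L k n ((1/((m:ℝ)+1) : ℝ) : ℂ)) atTop
      (𝓝 (∑' n, hh α L k n 0)) := by
    refine tendsto_tsum_of_dominated_convergence (summable_bd (L k * BB α k)) (fun n => ?_)
      (Eventually.of_forall fun m n => hh_bound α hα hα1 L hLpos hLlc k n _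
        (sector_pos α hα _ (by positivity)))
    refine ((hh_diff α hα1 L k n).continuous.tendsto 0).comp ?_
    have := tendsto_one_div_add_atTop_nhds_zero_nat (𝕜 := ℝ)
    exact_mod_cast (Complex.continuous_ofReal.tendsto 0).comp this
  have hle : ‖∑' n, hh α L k n 0‖ ≤ D := by
    refine le_of_tendsto htend.norm (Eventually.of_forall fun m => ?_)
    have hm := sector_pos α hα (1/((m:ℝ)+1)) (by positivity)
    rw [← T_iter α hα hα1 L hLpos hLlc k _ hm]
    exact hD _ hm
  have hsum : Summable fun n => coefT L n * quotSeq L n ^ k :=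
    Summable.of_nonneg_of_le (fun n => (mul_pos (coef_pos L hLpos n)
      (pow_pos (quot_pos L hLpos n) _)).le) (fun n => coef_le L hLpos hLlc n k)
      (summable_bd (L k))
  have h0 : ∑' n, hh α L k n 0 =
      ((∑' n, coefT L n * quotSeq L n ^ k : ℝ) : ℂ) * (k.factorial * aa α k) := by
    simp only [hh, mul_zero, EE_iter α hα1]
    rw [tsum_mul_right, Complex.ofReal_tsum]
  have hR : (1/2)^k * L k ≤ ∑' n, coefT L n * quotSeq L n ^ k := by
    rw [← coef_self L hLpos k]
    exact hsum.le_tsum k fun n _ => (mul_pos (coef_pos L hLpos n)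
      (pow_pos (quot_pos L hLpos n) _)).le
  have hLk := hLpos k
  have hR0 : 0 ≤ ∑' n, coefT L n * quotSeq L n ^ k := le_trans (by positivity) hR
  rw [h0, norm_mul, norm_mul, Complex.norm_real, Real.norm_of_nonneg hR0, aa_norm α hα1,
    Complex.norm_natCast] at hle
  have hup := gam_upper α hα hα1 k
  have hlo := gam_lower α hα1 k
  set Γ := Real.Gamma ((2 - α) * ((k:ℝ) + 1) + 2)
  have hf : (0:ℝ) < k.factorial := by positivity
  have hG := gbar_pos (1-α) k
  have hΓ : 0 < Γ := lt_of_lt_of_le hf hlo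
  have h1 : (1/2)^k * L k * (k.factorial * Γ⁻¹) ≤ D :=
    le_trans (mul_le_mul_of_nonneg_right hR (by positivity)) hle
  have h2 : (6 * 20^k * Gbar (1-α) k)⁻¹ ≤ k.factorial * Γ⁻¹ := by
    rw [← div_eq_mul_inv, inv_le_comm₀ (by positivity) (by positivity), inv_div,
      div_le_iff₀ hf]
    linarith
  have h3 : (1/2)^k * L k * (6 * 20^k * Gbar (1-α) k)⁻¹ ≤ D :=
    le_trans (mul_le_mul_of_nonneg_left h2 (by positivity)) h1
  rw [← div_eq_mul_inv, div_le_iff₀ (by positivity)] at h3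
  have h4 : L k = 2^k * ((1/2)^k * L k) := by
    rw [← mul_assoc, ← mul_pow]; norm_num
  rw [h4]
  calc _ ≤ 2^k * (D * (6 * 20^k * Gbar (1-α) k)) := by gcongr
    _ = _ := by rw [show (40:ℝ) = 2 * 20 by norm_num, mul_pow]; ring

/-- for `0 < α ≤ 1`, if `(j^{(1-α)j}M_j)_j` is equivalent to a log-convex
sequence `L`, then `T_L(Ẽ_α)` is characteristic in `A_{{M}}(S_α)`, where
`Ẽ_α(z) = ∑ (-1)^j z^j/Γ((2-α)(j+1)+2)`. -/
theorem stmt_6 (α : ℝ) (hα : 0 < α) (hα1 : α ≤ 1)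
    (M : ℕ → ℝ) (hMpos : ∀ j, 0 < M j) (hM0 : M 0 = 1)
    (L : ℕ → ℝ) (hLpos : ∀ j, 0 < L j) (hL0 : L 0 = 1) (hLlc : IsLogConvexSeq L)
    (hequiv : SeqEquiv (fun j => Gbar (1 - α) j * M j) L)
    (E : ℂ → ℂ)
    (hE : ∀ z : ℂ, E z =
      ∑' j : ℕ, ((-1:ℂ) ^ j * z ^ j) / ((Real.Gamma ((2 - α) * ((j:ℝ) + 1) + 2) : ℝ) : ℂ)) :
    Ttrans L E ∈ ASet M α ∧ Characteristic M α (Ttrans L E) := by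
  have hEE : E = EE α := by
    funext z
    rw [hE z, EE]
  subst hEE
  obtain ⟨A, hA, B, hB, hAB⟩ := hequiv
  have hmem : Ttrans L (EE α) ∈ ASet M α := by
    refine ⟨T_diff α hα hα1 L hLpos hLlc, 4 * Real.exp 1 * B, by positivity,
      2 * A * (Real.exp 1 * (2 * Real.pi)), fun j z hz => ?_⟩
    refine (T_bound α hα hα1 L hLpos hLlc j z hz).trans ?_
    have hG := gbar_pos (1-α) j
    have h1 : L j ≤ A * B ^ j * (Gbar (1 - α) j * M j) := (hAB j).2
    have h2 := BB_nonneg α j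
    calc _ ≤ 2 * ((A * B ^ j * (Gbar (1 - α) j * M j)) * BB α j) := by gcongr
      _ = _ := by
        rw [BB, mul_pow _ B]
        field_simp
  refine ⟨hmem, hmem, ?_⟩
  intro N hN hN0 hfN hsub
  refine Set.Subset.antisymm hsub ?_
  obtain ⟨-, h, hh0, C, hC⟩ := hfN
  have hMN : ∀ j, M j ≤ A * B ^ j * (C * h ^ j * N j * (6 * 40 ^ j)) := by
    intro j
    have hG := gbar_pos (1-α) j
    have h1 : Gbar (1 - α) j * M j ≤ A * B ^ j * L j := (hAB j).1
    have h2 := T_lower α hα hα1 L hLpos hLlc j _ (hC j)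
    have h3 : Gbar (1 - α) j * M j ≤
        A * B ^ j * (C * h ^ j * N j * (6 * 40 ^ j * Gbar (1 - α) j)) :=
      h1.trans (mul_le_mul_of_nonneg_left h2 (by positivity))
    refine le_of_mul_le_mul_left (h3.trans (le_of_eq ?_)) hG
    ring
  rintro f ⟨hfd, h', hh', C', hC'⟩
  refine ⟨hfd, h' * B * h * 40, by positivity, |C'| * A * C * 6, fun j z hz => ?_⟩
  have hMj := hMpos j
  calc _ ≤ C' * h' ^ j * M j := hC' j z hz
    _ ≤ |C'| * h' ^ j * M j := by gcongr; exact le_abs_self _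
    _ ≤ |C'| * h' ^ j * (A * B ^ j * (C * h ^ j * N j * (6 * 40 ^ j))) := by
      gcongr; exact hMN j
    _ = _ := by simp only [mul_pow]; ring
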